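/- Fix w ≥ 1 and let D be a set of strings over a linearly ordered alphabet Σ, each of length strictly greater than w, such that no element of D is a proper prefix of another element of D. Let q and q' be nonempty overlap-consistent lists of elements of D. If q strictly precedes q' in the lexicographic order on lists of strings induced by the lexicographic order on strings, then glue_w(q) is strictly lexicographically smaller than glue_w(q'). -/

import Mathlib

/-- `glue w [e₁, …, e_r] = e₁ ++ drop w e₂ ++ ⋯ ++ drop w e_r`. -/
def glue {σ : Type*} (w : ℕ) : List (List σ) → List σ
  | [] => []
  | e :: rest => e ++ (rest.map (List.drop w)).flatten

/-- `L` is overlap-consistent: the first `w` characters of each element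
coincide with the last `w` characters of the preceding one. -/
def OverlapConsistent {σ : Type*} (w : ℕ) (L : List (List σ)) : Prop :=
  List.Chain' (fun a b => b.take w = a.drop (a.length - w)) L

theorem aux_append {σ : Type*} [LinearOrder σ] {a b : List σ}
    (h : List.Lex (· < ·) a b) (hp : ¬ a <+: b) (s t : List σ) :
    List.Lex (· < ·) (a ++ s) (b ++ t) := by
  induction h with
  | nil => exact absurd List.nil_prefix hp
  | cons h ih =>
    exact List.Lex.cons (ih (fun h' => hp (by simpa using h')))
  | rel h => exact List.Lex.rel h

theorem aux_irrefl {σ : Type*} [LinearOrder σ] (a : List σ) :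
    ¬ List.Lex (· < ·) a a := by
  induction a with
  | nil => intro h; cases h
  | cons x a ih =>
    intro h
    cases h with
    | cons h => exact ih h
    | rel h => exact lt_irrefl _ h

theorem aux_cancel {σ : Type*} [LinearOrder σ] (p : List σ) {a b : List σ} 
    (h : List.Lex (· < ·) (p ++ a) (p ++ b)) : List.Lex (· < ·) a b := by
  induction p with
  | nil => exact h
  | cons x p ih =>
    cases h with
    | cons h => exact ih h
    | rel h => exact absurd h (lt_irrefl _)

theorem aux_left {σ : Type*} [LinearOrder σ] (p : List σ) {a b : List σ}
    (h : List.Lex (· < ·) a b) : List.Lex (· < ·) (p ++ a) (p ++ b) := by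
  induction p with
  | nil => exact h
  | cons x p ih => exact List.Lex.cons ih

theorem aux_main {σ : Type*} [LinearOrder σ] (w : ℕ)
    (D : Set (List σ)) (hlen : ∀ d ∈ D, w < d.length)
    (hpf : ∀ u ∈ D, ∀ v ∈ D, u <+: v → u = v)
    (l l' : List (List σ))
    (hlex : List.Lex (fun a b => List.Lex (· < ·) a b) l l') :
    ∀ e : List σ, (∀ e ∈ l, e ∈ D) → (∀ e ∈ l', e ∈ D) →
    OverlapConsistent w (e :: l) → OverlapConsistent w (e :: l') →
    List.Lex (· < ·) (l.map (List.drop w)).flatten (l'.map (List.drop w)).flatten := by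
  unfold OverlapConsistent
  induction hlex with
  | @nil b m =>
    intro e _ h2 _ _
    have := hlen b (h2 b (by simp))
    rcases hd : List.drop w b with _ | ⟨x, r⟩
    · have := congrArg List.length hd
      simp at this; omega
    · simp only [List.map_cons, List.flatten_cons, hd]
      exact List.Lex.nil
  | @cons a m m' h ih =>
    intro e h1 h2 c1 c2
    simp only [List.map_cons, List.flatten_cons]
    exact aux_left _ (ih a (fun x hx => h1 x (by simp [hx])) (fun x hx => h2 x (by simp [hx]))
      c1.tail c2.tail)
  | @rel a m b m' h =>
    intro e h1 h2 c1 c2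
    have e1 := (List.isChain_cons_cons.1 c1).1
    have e2 := (List.isChain_cons_cons.1 c2).1
    have hp : ¬ a <+: b := fun hp => by
      have := hpf a (h1 a (by simp)) b (h2 b (by simp)) hp
      subst this
      exact aux_irrefl _ h
    simp only [List.map_cons, List.flatten_cons]
    apply aux_cancel (List.take w a)
    rw [← List.append_assoc, List.take_append_drop, e1, ← e2, ← List.append_assoc,
      List.take_append_drop]
    exact aux_append h hp _ _

/-- if the parses compare strictly in the induced lexicographic
order on lists of strings, then the glued strings compare strictly in the
lexicographic order on strings. -/
theorem stmt_14 {σ : Type*} [LinearOrder σ] (w : ℕ) (hw : 1 ≤ w)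
    (D : Set (List σ)) (hlen : ∀ d ∈ D, w < d.length)
    (hpf : ∀ u ∈ D, ∀ v ∈ D, u <+: v → u = v)
    (q q' : List (List σ)) (hq : q ≠ []) (hq' : q' ≠ [])
    (hqD : ∀ e ∈ q, e ∈ D) (hq'D : ∀ e ∈ q', e ∈ D)
    (hoc : OverlapConsistent w q) (hoc' : OverlapConsistent w q')
    (hlex : List.Lex (fun a b => List.Lex (· < ·) a b) q q') :
    List.Lex (· < ·) (glue w q) (glue w q') := by
  cases hlex with
  | nil => exact absurd rfl hq
  | @cons a m m' h =>
    exact aux_left a (aux_main w D hlen hpf m m' h a (fun x hx => hqD x (by simp [hx]))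
      (fun x hx => hq'D x (by simp [hx])) hoc hoc')
  | @rel a m b m' h =>
    refine aux_append h (fun hp => ?_) _ _
    have := hpf a (hqD a (by simp)) b (hq'D b (by simp)) hp
    subst this
    exact aux_irrefl _ h
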